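/- arXiv:1910.03796 — 2 statements merged into one kernel-verified Lean document; each statement's English description precedes it below -/
import Mathlib

section
/- Fix ν ∈ [0,1] with ν ≠ 1/2 and consider the two-state arbitrarily varying channel L_ν with L_{ν,0} = BSC(ν) and L_{ν,1} = BSC(1−ν). A binary channel U (with transition probabilities u(s|x), s,x ∈ {0,1}) is a symmetrizer for L_ν, i.e., satisfies ∑_{s∈{0,1}} u(s|x')·L_{ν,s}(y|x) = ∑_{s∈{0,1}} u(s|x)·L_{ν,s}(y|x') for all x, x', y ∈ {0,1}, if and only if U = BSC(θ) for some θ ∈ [0,1], i.e., u(1|0) = u(0|1). In particular, every BSC(θ) symmetrizes L_ν (for every ν), and for ν ≠ 1/2 these are the only symmetrizers. -/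
/-- The binary symmetric channel with flip probability `ν`. -/
noncomputable def bsc (ν : ℝ) (c z : ZMod 2) : ℝ := if c = z then 1 - ν else ν

/-- The two-state arbitrarily varying channel `L_ν`: state `0` gives `BSC(ν)`,
state `1` gives `BSC(1-ν)`. -/
noncomputable def Lavc (ν : ℝ) (s : ZMod 2) : ZMod 2 → ZMod 2 → ℝ :=
  if s = 0 then bsc ν else bsc (1 - ν)

theorem ZMod.sum_univ_two {M : Type*} [AddCommMonoid M] (f : ZMod 2 → M) :
    ∑ s, f s = f 0 + f 1 :=
  Fin.sum_univ_two f

theorem ZMod.forall_two {p : ZMod 2 → Prop} : (∀ x, p x) ↔ p 0 ∧ p 1 :=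
  Fin.forall_fin_two

/-- A binary channel whose two crossover probabilities agree symmetrizes every `L_μ`. -/
theorem symmetrizes_of_crossover_eq {U : ZMod 2 → ZMod 2 → ℝ} (hU : ∀ x, ∑ s, U x s = 1)
    (h : U 0 1 = U 1 0) (μ : ℝ) (x x' y : ZMod 2) :
    ∑ s, U x' s * Lavc μ s y x = ∑ s, U x s * Lavc μ s y x' := by
  have h0 : U 0 0 = 1 - U 1 0 := by linarith [hU 0, ZMod.sum_univ_two (U 0)]
  have h1 : U 1 1 = 1 - U 1 0 := by linarith [hU 1, ZMod.sum_univ_two (U 1)]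
  revert x x' y
  simp only [ZMod.forall_two, ZMod.sum_univ_two, h, h0, h1, Lavc, bsc, one_ne_zero, zero_ne_one,
    if_true, if_false, and_self, true_and, and_true]
  refine ⟨⟨?_, ?_⟩, ?_, ?_⟩ <;> ring

/-- For `ν ≠ 1/2`, the crossover probabilities of a symmetrizer of `L_ν` agree. -/
theorem crossover_eq_of_symmetrizes {ν : ℝ} (hν : ν ≠ 1/2) {U : ZMod 2 → ZMod 2 → ℝ}
    (hU : ∀ x, ∑ s, U x s = 1)
    (h : ∀ x x' y : ZMod 2, ∑ s, U x' s * Lavc ν s y x = ∑ s, U x s * Lavc ν s y x') :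
    U 0 1 = U 1 0 := by
  have h0 : U 0 0 = 1 - U 0 1 := by linarith [hU 0, ZMod.sum_univ_two (U 0)]
  have h1 : U 1 1 = 1 - U 1 0 := by linarith [hU 1, ZMod.sum_univ_two (U 1)]
  have key := h 0 1 0
  simp only [ZMod.sum_univ_two, h0, h1, Lavc, bsc, one_ne_zero, zero_ne_one,
    if_true, if_false] at key
  have hne : 1 - 2 * ν ≠ 0 := fun h' => hν (by linarith)
  exact mul_right_cancel₀ hne (by linarith)

theorem sum_bsc (θ : ℝ) (x : ZMod 2) : ∑ s, bsc θ s x = 1 := by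
  revert x
  simp [ZMod.forall_two, ZMod.sum_univ_two, bsc]

theorem bsc_one_zero_eq (θ : ℝ) : bsc θ 1 0 = bsc θ 0 1 := by
  simp [bsc]

/-- A binary channel is a `BSC(θ)` iff its crossover probabilities agree. -/
theorem crossover_eq_iff_exists_bsc {U : ZMod 2 → ZMod 2 → ℝ}
    (hU0 : ∀ x s, 0 ≤ U x s) (hU1 : ∀ x, ∑ s, U x s = 1) :
    U 0 1 = U 1 0 ↔ ∃ θ ∈ Set.Icc (0:ℝ) 1, ∀ x s, U x s = bsc θ s x := by
  constructor
  · intro h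
    have h0 : U 0 0 = 1 - U 0 1 := by linarith [hU1 0, ZMod.sum_univ_two (U 0)]
    have h1 : U 1 1 = 1 - U 0 1 := by linarith [hU1 1, ZMod.sum_univ_two (U 1)]
    refine ⟨U 0 1, ⟨hU0 0 1, by linarith [hU0 0 0]⟩, ?_⟩
    simp [ZMod.forall_two, bsc, h0, h1, h]
  · rintro ⟨θ, -, h⟩
    rw [h, h, bsc_one_zero_eq]

/-- For `ν ≠ 1/2`, a binary channel `U` (with `U x s = u(s|x)`)
symmetrizes `L_ν` iff it is a binary symmetric channel `BSC(θ)` for some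
`θ ∈ [0,1]` (equivalently `u(1|0) = u(0|1)`); moreover every `BSC(θ)`
symmetrizes `L_μ` for every `μ`. -/
theorem symmetrizers_of_Lnu
    (ν : ℝ) (hν : ν ∈ Set.Icc (0:ℝ) 1) (hν2 : ν ≠ 1/2)
    (U : ZMod 2 → ZMod 2 → ℝ)
    (hU0 : ∀ x s, 0 ≤ U x s) (hU1 : ∀ x, ∑ s, U x s = 1) :
    ((∀ x x' y : ZMod 2,
        ∑ s, U x' s * Lavc ν s y x = ∑ s, U x s * Lavc ν s y x')
      ↔ (U 0 1 = U 1 0)) ∧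
    ((∀ x x' y : ZMod 2,
        ∑ s, U x' s * Lavc ν s y x = ∑ s, U x s * Lavc ν s y x')
      ↔ (∃ θ ∈ Set.Icc (0:ℝ) 1, ∀ x s, U x s = bsc θ s x)) ∧
    (∀ μ ∈ Set.Icc (0:ℝ) 1, ∀ θ ∈ Set.Icc (0:ℝ) 1, ∀ x x' y : ZMod 2,
        ∑ s, bsc θ s x' * Lavc μ s y x = ∑ s, bsc θ s x * Lavc μ s y x') := by
  have hiff : (∀ x x' y : ZMod 2,
      ∑ s, U x' s * Lavc ν s y x = ∑ s, U x s * Lavc ν s y x') ↔ U 0 1 = U 1 0 :=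
    ⟨crossover_eq_of_symmetrizes hν2 hU1, fun h => symmetrizes_of_crossover_eq hU1 h ν⟩
  exact ⟨hiff, hiff.trans (crossover_eq_iff_exists_bsc hU0 hU1), fun μ _ θ _ =>
    symmetrizes_of_crossover_eq (U := fun x s => bsc θ s x) (sum_bsc θ) (bsc_one_zero_eq θ) μ⟩
end

section
/- For every ε ∈ [0, 1/2] and all probability distributions p₁, p₂ on {0,1}: I(p₁ ⊗ p₂ ; BSC(1/2 − ε) ∘ I) ≤ 2 − 2·h(1/2 − √(ε/2)), where BSC(1/2 − ε) ∘ I is the multiple-access channel (c | a,b) ↦ BSC(1/2−ε)(c | a⊕b). (The key identity is that BSC(1/2−ε) = BSC(ρ) ∘ BSC(ρ) with ρ = 1/2 − √(ε/2), since 2ρ(1−ρ) = 1/2 − ε.) -/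
/-- Base-2 Shannon entropy of a (sub)distribution on a finite set,
with the convention `0·log 0 = 0` (automatic since `Real.logb 2 0 = 0`). -/
noncomputable def shannonH {α : Type*} [Fintype α] (p : α → ℝ) : ℝ :=
  -∑ a, p a * Real.logb 2 (p a)

/-- Binary entropy `h(x) = −x·log₂ x − (1−x)·log₂(1−x)`. -/
noncomputable def binH (x : ℝ) : ℝ :=
  -(x * Real.logb 2 x) - (1 - x) * Real.logb 2 (1 - x)

/-- Mutual information `I(p;W) = H(p) + H(Wp) − H((W,p))` of an input distribution
`p` on `α` and a channel `W` from `α` to `{0,1}` (here `W c z = W(c|z)`). -/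
noncomputable def mutInfo {α : Type*} [Fintype α] (p : α → ℝ)
    (W : ZMod 2 → α → ℝ) : ℝ :=
  shannonH p + shannonH (fun c => ∑ z, W c z * p z)
    - shannonH (fun q : ZMod 2 × α => W q.1 q.2 * p q.2)

open Real in
lemma shannonH_eq_sum_negMulLog {α : Type*} [Fintype α] (p : α → ℝ) :
    shannonH p = (∑ a, negMulLog (p a)) / log 2 := by
  rw [shannonH, ← Finset.sum_neg_distrib, Finset.sum_div]
  refine Finset.sum_congr rfl fun a _ => ?_
  rw [negMulLog, logb]
  ring

lemma binH_eq_binEntropy (x : ℝ) : binH x = Real.binEntropy x / Real.log 2 := by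
  rw [binH, Real.binEntropy_eq_negMulLog_add_negMulLog_one_sub, Real.negMulLog, Real.negMulLog,
    Real.logb, Real.logb]
  ring

lemma sum_zmod_two (f : ZMod 2 → ℝ) : ∑ c, f c = f 0 + f 1 :=
  Fin.sum_univ_two f

lemma sum_bsc_s15 (ν : ℝ) (z : ZMod 2) : ∑ c, bsc ν c z = 1 := by
  have hz : z = 0 ∨ z = 1 := by revert z; decide
  rcases hz with rfl | rfl <;> simp [sum_zmod_two, bsc]

lemma shannonH_bsc (ν : ℝ) (z : ZMod 2) : shannonH (fun c => bsc ν c z) = binH ν := by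
  have hz : z = 0 ∨ z = 1 := by revert z; decide
  rw [shannonH, binH]
  rcases hz with rfl | rfl <;> simp [sum_zmod_two, bsc] <;> ring

/-- A distribution on `{0,1}` has entropy at most one bit. -/
lemma shannonH_zmod_two_le_one (q : ZMod 2 → ℝ) (hq : ∑ c, q c = 1) : shannonH q ≤ 1 := by
  rw [sum_zmod_two] at hq
  rw [shannonH_eq_sum_negMulLog, sum_zmod_two, eq_sub_of_add_eq' hq,
    ← Real.binEntropy_eq_negMulLog_add_negMulLog_one_sub,
    div_le_one (Real.log_pos one_lt_two)]
  exact Real.binEntropy_le_log_two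

/-- The chain rule `H((W,p)) = H(p) + ∑ z, p z * H(W(·|z))`. -/
lemma shannonH_joint {α : Type*} [Fintype α] (p : α → ℝ) (W : ZMod 2 → α → ℝ)
    (hW : ∀ z, ∑ c, W c z = 1) :
    shannonH (fun q : ZMod 2 × α => W q.1 q.2 * p q.2)
      = shannonH p + ∑ z, p z * shannonH (fun c => W c z) := by
  simp only [shannonH_eq_sum_negMulLog, Fintype.sum_prod_type_right, Real.negMulLog_mul,
    Finset.sum_add_distrib, ← Finset.mul_sum, ← Finset.sum_mul, hW, one_mul, mul_div_assoc',
    ← Finset.sum_div]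
  ring

/-- A binary-output channel all of whose rows have entropy `h` carries at most `1 - h` bits. -/
lemma mutInfo_le_one_sub {α : Type*} [Fintype α] (p : α → ℝ) (W : ZMod 2 → α → ℝ) (h : ℝ)
    (hp : ∑ z, p z = 1) (hW : ∀ z, ∑ c, W c z = 1)
    (hH : ∀ z, shannonH (fun c => W c z) = h) :
    mutInfo p W ≤ 1 - h := by
  have hout : shannonH (fun c => ∑ z, W c z * p z) ≤ 1 := by
    apply shannonH_zmod_two_le_one
    rw [Finset.sum_comm]
    simp [← Finset.sum_mul, hW, hp]
  have hjoint := shannonH_joint p W hW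
  simp only [hH, ← Finset.sum_mul, hp, one_mul] at hjoint
  rw [mutInfo, hjoint]
  linarith

lemma binH_le_one (x : ℝ) : binH x ≤ 1 := by
  rw [binH_eq_binEntropy, div_le_one (Real.log_pos one_lt_two)]
  exact Real.binEntropy_le_log_two

lemma binH_le_binH {x y : ℝ} (hx : 0 ≤ x) (hxy : x ≤ y) (hy : y ≤ 1 / 2) :
    binH x ≤ binH y := by
  rw [binH_eq_binEntropy, binH_eq_binEntropy]
  have hlog := Real.log_pos one_lt_two
  gcongr
  rw [one_div] at hy
  exact Real.binEntropy_strictMonoOn.monotoneOn ⟨hx, hxy.trans hy⟩ ⟨hx.trans hxy, hy⟩ hxy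

/-- for every `ε ∈ [0,1/2]` and product input distribution `p₁ ⊗ p₂`,
the mutual information through the multiple-access channel `BSC(1/2−ε) ∘ I`
(i.e. `(c|a,b) ↦ BSC(1/2−ε)(c|a⊕b)`) is at most `2 − 2·h(1/2 − √(ε/2))`. -/
theorem sum_rate_bound (ε : ℝ) (hε : ε ∈ Set.Icc (0:ℝ) (1/2))
    (p₁ p₂ : ZMod 2 → ℝ)
    (h₁0 : ∀ a, 0 ≤ p₁ a) (h₁1 : ∑ a, p₁ a = 1)
    (h₂0 : ∀ b, 0 ≤ p₂ b) (h₂1 : ∑ b, p₂ b = 1) :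
    mutInfo (fun ab : ZMod 2 × ZMod 2 => p₁ ab.1 * p₂ ab.2)
        (fun c ab => bsc (1/2 - ε) c (ab.1 + ab.2))
      ≤ 2 - 2 * binH (1/2 - Real.sqrt (ε/2)) := by
  have hρ : 0 ≤ 1 / 2 - Real.sqrt (ε / 2) := by
    rw [sub_nonneg, Real.sqrt_le_left (by norm_num)]
    linarith [hε.2]
  have hle : ε ≤ Real.sqrt (ε / 2) := by
    apply Real.le_sqrt_of_sq_le
    nlinarith [hε.1, hε.2]
  have hmono : binH (1 / 2 - Real.sqrt (ε / 2)) ≤ binH (1 / 2 - ε) :=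
    binH_le_binH hρ (by linarith) (by linarith [hε.1])
  have hone := binH_le_one (1 / 2 - Real.sqrt (ε / 2))
  have hinfo : mutInfo (fun ab : ZMod 2 × ZMod 2 => p₁ ab.1 * p₂ ab.2)
      (fun c ab => bsc (1 / 2 - ε) c (ab.1 + ab.2)) ≤ 1 - binH (1 / 2 - ε) := by
    refine mutInfo_le_one_sub _ _ _ ?_ (fun z => sum_bsc_s15 _ _) (fun z => shannonH_bsc _ _)
    rw [Fintype.sum_prod_type, ← Fintype.sum_mul_sum, h₁1, h₂1, one_mul]
  linarith
end
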